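/- For balls in R^d, the 0-fractional curvature satisfies H^0(ρx, \bar B_ρ) = H^0(x, \bar B_1) − d ω_d log ρ for all ρ > 0 and x ∈ ∂B_1. In particular, there exists K > 0 such that H^0(ρx, \bar B_ρ) ≥ −Kρ for all ρ ≥ 1. -/

import Mathlib

open MeasureTheory Metric Filter Set

/-- Volume of the unit ball in `ℝ^d` (the constant `ω_d`). -/
noncomputable def unitBallVol (d : ℕ) : ℝ :=
  (volume (Metric.ball (0 : EuclideanSpace ℝ (Fin d)) 1)).toReal

/-- `χ_{ℝ^d ∖ E}(y) - χ_E(y)`. -/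
noncomputable def chiDiff {d : ℕ} (E : Set (EuclideanSpace ℝ (Fin d)))
    (y : EuclideanSpace ℝ (Fin d)) : ℝ :=
  Set.indicator Eᶜ (fun _ => (1:ℝ)) y - Set.indicator E (fun _ => (1:ℝ)) y

/-- The unit vector `e_d` (last coordinate direction) in `ℝ^d`. -/
noncomputable def ed (d : ℕ) : EuclideanSpace ℝ (Fin d) :=
  if h : 0 < d then EuclideanSpace.single (⟨d - 1, by omega⟩ : Fin d) 1 else 0

/-- `H` is the value of the `s`-fractional curvature of `E` at `x`, defined as the
principal value `lim_{r→0⁺} ∫_{ℝ^d ∖ B_r(x)} (χ_{Eᶜ}(y) - χ_E(y))/|x-y|^{d+s} dy`. -/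
def HasFracCurv {d : ℕ} (s : ℝ) (E : Set (EuclideanSpace ℝ (Fin d)))
    (x : EuclideanSpace ℝ (Fin d)) (H : ℝ) : Prop :=
  Tendsto (fun r : ℝ => ∫ y in (Metric.ball x r)ᶜ, chiDiff E y / ‖y - x‖ ^ ((d:ℝ) + s))
    (nhdsWithin 0 (Set.Ioi 0)) (nhds H)

/-- Uniform two-sided (interior and exterior) tangent ball condition: the standard
geometric characterization of a set with compact boundary of class `C^{1,1}`. -/
def TwoSidedBallCond {d : ℕ} (E : Set (EuclideanSpace ℝ (Fin d))) : Prop :=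
  ∃ δ > 0, ∀ x ∈ frontier E, ∃ ν : EuclideanSpace ℝ (Fin d), ‖ν‖ = 1 ∧
    Metric.ball (x - δ • ν) δ ⊆ E ∧ Metric.ball (x + δ • ν) δ ⊆ Eᶜ

/-- The `0`-fractional curvature `H^0(x,E)`, defined with the cutoff radius
`R = diam E + 1 > diam E` (the value is independent of the choice of `R > diam E`). -/
noncomputable def H0 {d : ℕ} (E : Set (EuclideanSpace ℝ (Fin d)))
    (x : EuclideanSpace ℝ (Fin d)) : ℝ :=
  limUnder (nhdsWithin (0:ℝ) (Set.Ioi 0))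
    (fun r => ∫ y in Metric.ball x (Metric.diam E + 1) \ Metric.ball x r,
      chiDiff E y / ‖y - x‖ ^ (d:ℝ))
  - d * unitBallVol d * Real.log (Metric.diam E + 1)

/-- The `s`-Riesz curvature `K^s(x,E) = -2 ∫_E |x-y|^{-(d+s)} dy` of a compact set. -/
noncomputable def Ks {d : ℕ} (s : ℝ) (E : Set (EuclideanSpace ℝ (Fin d)))
    (x : EuclideanSpace ℝ (Fin d)) : ℝ :=
  -2 * ∫ y in E, 1 / ‖x - y‖ ^ ((d:ℝ) + s)

/-- Outer Minkowski curvature `κ_r^{ou}(x,E)` relative to a normal (vector) field `ν`. -/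
noncomputable def kappaOut {d : ℕ} (E : Set (EuclideanSpace ℝ (Fin d)))
    (ν : EuclideanSpace ℝ (Fin d) → EuclideanSpace ℝ (Fin d)) (r : ℝ)
    (x : EuclideanSpace ℝ (Fin d)) : ℝ :=
  if Metric.infDist (x + r • ν x) E = r then
    (1 / (2 * r)) * LinearMap.det
      ((ContinuousLinearMap.id ℝ (EuclideanSpace ℝ (Fin d)) + r • fderiv ℝ ν x).toLinearMap)
  else 0

/-- Inner Minkowski curvature `κ_r^{in}(x,E)` relative to a normal (vector) field `ν`. -/
noncomputable def kappaIn {d : ℕ} (E : Set (EuclideanSpace ℝ (Fin d)))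
    (ν : EuclideanSpace ℝ (Fin d) → EuclideanSpace ℝ (Fin d)) (r : ℝ)
    (x : EuclideanSpace ℝ (Fin d)) : ℝ :=
  if Metric.infDist (x - r • ν x) Eᶜ = r then
    -(1 / (2 * r)) * LinearMap.det
      ((ContinuousLinearMap.id ℝ (EuclideanSpace ℝ (Fin d)) - r • fderiv ℝ ν x).toLinearMap)
  else 0

/-- Regularized Minkowski curvature `κ_r^f(x,E) = ∫_0^1 (-s f'(s)) κ_{rs}(x,E) ds`. -/
noncomputable def kappaF {d : ℕ} (f : ℝ → ℝ) (E : Set (EuclideanSpace ℝ (Fin d)))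
    (ν : EuclideanSpace ℝ (Fin d) → EuclideanSpace ℝ (Fin d)) (r : ℝ)
    (x : EuclideanSpace ℝ (Fin d)) : ℝ :=
  ∫ t in Set.Ioc (0:ℝ) 1, (-t * deriv f t) * (kappaOut E ν (r*t) x + kappaIn E ν (r*t) x)

section FractionalCurvatureOfBalls

open scoped RealInnerProductSpace

/-- The kernel `|h|^{-d}` restricted to the directions `h` for which both `x + h` and `x - h` lie
outside the closed unit ball, when `x` is a unit vector. -/
noncomputable def gapKernel {d : ℕ} (x h : EuclideanSpace ℝ (Fin d)) : ℝ :=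
  Set.indicator {h : EuclideanSpace ℝ (Fin d) | 2 * |⟪x, h⟫| < ‖h‖ ^ 2}
    (fun h => 1 / ‖h‖ ^ (d : ℝ)) h

theorem gapKernel_nonneg {d : ℕ} (x h : EuclideanSpace ℝ (Fin d)) : 0 ≤ gapKernel x h :=
  Set.indicator_nonneg (fun _ _ => by positivity) _

theorem measurable_gapKernel {d : ℕ} (x : EuclideanSpace ℝ (Fin d)) :
    Measurable (gapKernel x) := by
  refine Measurable.indicator (by fun_prop) ?_
  exact measurableSet_lt (by fun_prop) (by fun_prop)

theorem integrable_indicator_abs_rpow {s : ℝ} (hs : -1 < s) (S : ℝ) :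
    Integrable (Set.indicator (Ioo (-S) S) fun t : ℝ => |t| ^ s) := by
  rw [integrable_indicator_iff measurableSet_Ioo]
  rcases le_or_gt S 0 with hS | hS
  · rw [Ioo_eq_empty (by linarith)]
    exact integrableOn_empty
  have hpos : IntegrableOn (fun t : ℝ => |t| ^ s) (Ioo 0 S) :=
    ((intervalIntegral.integrableOn_Ioo_rpow_iff hS).2 hs).congr_fun
      (fun t ht => by simp only [abs_of_pos ht.1]) measurableSet_Ioo
  have hneg : IntegrableOn (fun t : ℝ => |t| ^ s) (Ioo (-S) 0) := by
    simpa using hpos.comp_neg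
  have hzero : IntegrableOn (fun t : ℝ => |t| ^ s) {0} := by simp
  refine ((hneg.union hzero).union hpos).mono_set fun t ht => ?_
  rcases lt_trichotomy t 0 with h | h | h
  · exact Or.inl (Or.inl ⟨ht.1, h⟩)
  · exact Or.inl (Or.inr h)
  · exact Or.inr ⟨h, ht.2⟩

theorem prod_abs_rpow_le {d : ℕ} (a : Fin d → ℝ) (i₀ : Fin d) {N : ℝ} (hN : 0 < N)
    (ha : ∀ i, |a i| ≤ N) (ha₀ : |a i₀| ≤ N ^ 2) :
    ∏ i, |a i| ^ ((d : ℝ) / (d + 1)) ≤ N ^ (d : ℝ) := by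
  have ht : (0 : ℝ) ≤ (d : ℝ) / (d + 1) := by positivity
  rw [← Finset.mul_prod_erase _ _ (Finset.mem_univ i₀)]
  have h1 : |a i₀| ^ ((d : ℝ) / (d + 1)) ≤ (N ^ 2) ^ ((d : ℝ) / (d + 1)) :=
    Real.rpow_le_rpow (abs_nonneg _) ha₀ ht
  have h2 : ∏ i ∈ Finset.univ.erase i₀, |a i| ^ ((d : ℝ) / (d + 1))
      ≤ ∏ _i ∈ Finset.univ.erase i₀, N ^ ((d : ℝ) / (d + 1)) :=
    Finset.prod_le_prod (fun i _ => by positivity)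
      fun i _ => Real.rpow_le_rpow (abs_nonneg _) (ha i) ht
  have hd : 0 < d := i₀.pos
  calc _ ≤ (N ^ 2) ^ ((d : ℝ) / (d + 1)) *
        ∏ _i ∈ Finset.univ.erase i₀, N ^ ((d : ℝ) / (d + 1)) := by gcongr
    _ = N ^ (d : ℝ) := by
      rw [Finset.prod_const, Finset.card_erase_of_mem (Finset.mem_univ _), Finset.card_univ,
        Fintype.card_fin, ← Real.rpow_natCast N 2, ← Real.rpow_mul hN.le, ← Real.rpow_natCast,
        ← Real.rpow_mul hN.le, ← Real.rpow_add hN, Nat.cast_sub hd]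
      congr 1
      have : (d : ℝ) + 1 ≠ 0 := by positivity
      field_simp
      push_cast
      ring

theorem integrableOn_gapKernel {d : ℕ} (hd : 0 < d) {x : EuclideanSpace ℝ (Fin d)}
    (hx : ‖x‖ = 1) (S : ℝ) : IntegrableOn (gapKernel x) (ball 0 S) := by
  set i₀ : Fin d := ⟨0, hd⟩
  obtain ⟨b, hb⟩ := Orthonormal.exists_orthonormalBasis_extension_of_card_eq (𝕜 := ℝ)
    (E := EuclideanSpace ℝ (Fin d)) (ι := Fin d) (by simp) (v := fun _ => x) (s := {i₀})
    (by
      refine ⟨fun _ => hx, fun i j hij => ?_⟩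
      exact absurd (Subsingleton.elim i j) hij)
  have hb₀ : b i₀ = x := hb i₀ rfl
  set t : ℝ := (d : ℝ) / (d + 1)
  have ht : -1 < -t := by
    have : t < 1 := (div_lt_one (by positivity)).2 (by linarith)
    linarith
  set φ : ℝ → ℝ := Set.indicator (Ioo (-S) S) fun u : ℝ => |u| ^ (-t)
  have hφ : Integrable φ := integrable_indicator_abs_rpow ht S
  have hP : Integrable (fun v : Fin d → ℝ => ∏ i, φ (v i)) :=
    Integrable.fintype_prod (μ := fun _ => volume) fun _ => hφ
  have hmp : MeasurePreserving (fun h : EuclideanSpace ℝ (Fin d) => (b.repr h).ofLp) :=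
    (PiLp.volume_preserving_ofLp (Fin d)).comp b.measurePreserving_repr
  have hH : Integrable fun h : EuclideanSpace ℝ (Fin d) => ∏ i, φ ((b.repr h).ofLp i) :=
    hmp.integrable_comp_of_integrable hP
  have hne : ∀ᵐ h : EuclideanSpace ℝ (Fin d), ∀ i, (b.repr h).ofLp i ≠ 0 := by
    have : ∀ᵐ v : Fin d → ℝ, ∀ i, v i ≠ 0 :=
      ae_all_iff.2 fun i => Measure.ae_eval_ne (fun _ => volume) i 0
    exact hmp.quasiMeasurePreserving.ae this
  refine hH.integrableOn.mono' (measurable_gapKernel x).aestronglyMeasurable ?_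
  filter_upwards [ae_restrict_mem measurableSet_ball, ae_restrict_of_ae hne] with h hS h0
  have hle : ∀ i, |(b.repr h).ofLp i| ≤ ‖h‖ := fun i => by
    have := PiLp.norm_apply_le (b.repr h) i
    rwa [b.repr.norm_map] at this
  have hS' : ‖h‖ < S := by simpa using hS
  have hφe : ∀ i, φ ((b.repr h).ofLp i) = (|(b.repr h).ofLp i| ^ t)⁻¹ := fun i => by
    have : (b.repr h).ofLp i ∈ Ioo (-S) S := abs_lt.1 ((hle i).trans_lt hS')
    simp only [φ, Set.indicator_of_mem this, Real.rpow_neg (abs_nonneg _)]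
  simp only [hφe, Finset.prod_inv_distrib]
  rw [Real.norm_of_nonneg (gapKernel_nonneg x h)]
  unfold gapKernel
  refine Set.indicator_apply_le' (fun hh => ?_) fun _ => by positivity
  have hin : (b.repr h).ofLp i₀ = ⟪x, h⟫ := by rw [b.repr_apply_apply, hb₀]
  have hN : 0 < ‖h‖ := (abs_pos.2 (h0 i₀)).trans_le (hle i₀)
  rw [one_div]
  refine inv_anti₀ (Finset.prod_pos fun i _ => Real.rpow_pos_of_pos (abs_pos.2 (h0 i)) _)
    (prod_abs_rpow_le _ i₀ hN hle ?_)
  rw [hin]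
  have hh' : 2 * |⟪x, h⟫| < ‖h‖ ^ 2 := hh
  linarith [abs_nonneg ⟪x, h⟫]

theorem chiDiff_closedBall_add {d : ℕ} {x : EuclideanSpace ℝ (Fin d)} (hx : ‖x‖ = 1)
    (h : EuclideanSpace ℝ (Fin d)) :
    chiDiff (closedBall 0 1) (x + h) = if 2 * ⟪x, h⟫ + ‖h‖ ^ 2 ≤ 0 then -1 else 1 := by
  have key : x + h ∈ closedBall (0 : EuclideanSpace ℝ (Fin d)) 1 ↔
      2 * ⟪x, h⟫ + ‖h‖ ^ 2 ≤ 0 := by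
    rw [mem_closedBall_zero_iff, ← abs_of_nonneg (norm_nonneg (x + h)), ← sq_le_one_iff_abs_le_one,
      norm_add_sq_real, hx]
    constructor <;> intro _ <;> linarith
  unfold chiDiff
  split_ifs with hc
  · simp [Set.indicator, key, hc]
  · simp [Set.indicator, key, hc]

theorem chiDiff_add_chiDiff_reflect {d : ℕ} {x : EuclideanSpace ℝ (Fin d)} (hx : ‖x‖ = 1)
    {h : EuclideanSpace ℝ (Fin d)} (hh : h ≠ 0) :
    chiDiff (closedBall 0 1) (x + h) / ‖h‖ ^ (d : ℝ) +
      chiDiff (closedBall 0 1) (x + -h) / ‖-h‖ ^ (d : ℝ) = 2 * gapKernel x h := by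
  have hpos : 0 < ‖h‖ ^ 2 := by positivity
  rw [chiDiff_closedBall_add hx, chiDiff_closedBall_add hx, norm_neg, inner_neg_right, ← add_div]
  unfold gapKernel
  by_cases hc : 2 * |⟪x, h⟫| < ‖h‖ ^ 2
  · rw [Set.indicator_of_mem (by exact hc)]
    have := neg_abs_le ⟪x, h⟫
    have := le_abs_self ⟪x, h⟫
    rw [if_neg (by linarith), if_neg (by linarith)]
    ring
  · rw [Set.indicator_of_notMem (by exact hc)]
    rcases abs_cases ⟪x, h⟫ with ⟨he, _⟩ | ⟨he, _⟩ <;> rw [he] at hc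
    · rw [if_neg (by linarith), if_pos (by linarith)]
      simp
    · rw [if_pos (by linarith), if_neg (by linarith)]
      simp

theorem measurable_chiDiff {d : ℕ} {E : Set (EuclideanSpace ℝ (Fin d))} (hE : MeasurableSet E) :
    Measurable (chiDiff E) :=
  (measurable_const.indicator hE.compl).sub (measurable_const.indicator hE)

theorem abs_chiDiff_le {d : ℕ} (E : Set (EuclideanSpace ℝ (Fin d)))
    (y : EuclideanSpace ℝ (Fin d)) : |chiDiff E y| ≤ 1 := by
  by_cases h : y ∈ E <;> simp [chiDiff, h]

/-- Symmetrization about the boundary point `x` of the unit ball. -/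
theorem setIntegral_chiDiff_eq_gapKernel {d : ℕ} {x : EuclideanSpace ℝ (Fin d)} (hx : ‖x‖ = 1)
    (S : ℝ) {r : ℝ} (hr : 0 < r) :
    ∫ h in ball (0 : EuclideanSpace ℝ (Fin d)) S \ ball 0 r,
        chiDiff (closedBall 0 1) (x + h) / ‖h‖ ^ (d : ℝ) =
      ∫ h in ball (0 : EuclideanSpace ℝ (Fin d)) S \ ball 0 r, gapKernel x h := by
  set A : Set (EuclideanSpace ℝ (Fin d)) := ball 0 S \ ball 0 r with hA
  set k : EuclideanSpace ℝ (Fin d) → ℝ :=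
    fun h => chiDiff (closedBall 0 1) (x + h) / ‖h‖ ^ (d : ℝ) with hk
  have hAm : MeasurableSet A := measurableSet_ball.diff measurableSet_ball
  have hAneg : -A = A := by
    ext h
    simp [hA]
  have hAr : ∀ h ∈ A, r ≤ ‖h‖ := fun h hh => by simpa using hh.2
  have hkm : Measurable k :=
    ((measurable_chiDiff measurableSet_closedBall).comp (measurable_const_add x)).div
      (by fun_prop)
  have hkint : IntegrableOn k A := by
    refine IntegrableOn.of_bound (C := (r ^ (d : ℝ))⁻¹)
      ((measure_mono sdiff_subset).trans_lt measure_ball_lt_top) hkm.aestronglyMeasurable ?_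
    filter_upwards [ae_restrict_mem hAm] with h hh
    have h1 : r ^ (d : ℝ) ≤ ‖h‖ ^ (d : ℝ) := Real.rpow_le_rpow hr.le (hAr h hh) (by positivity)
    have h2 : 0 < r ^ (d : ℝ) := Real.rpow_pos_of_pos hr _
    rw [hk, Real.norm_eq_abs, abs_div, abs_of_nonneg (h2.le.trans h1), inv_eq_one_div]
    exact div_le_div₀ zero_le_one (abs_chiDiff_le _ _) h2 h1
  have hneg : ∫ h in A, k (-h) = ∫ h in A, k h := by
    have := (Measure.measurePreserving_neg
      (volume : Measure (EuclideanSpace ℝ (Fin d)))).setIntegral_preimage_emb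
      (MeasurableEquiv.neg _).measurableEmbedding k A
    rwa [Set.neg_preimage, hAneg] at this
  have hknint : IntegrableOn (fun h => k (-h)) A := by
    have := hkint.comp_neg
    rwa [hAneg] at this
  have hsum : ∫ h in A, (k h + k (-h)) = ∫ h in A, 2 * gapKernel x h :=
    setIntegral_congr_fun hAm fun h hh => chiDiff_add_chiDiff_reflect hx
      (norm_pos_iff.1 (hr.trans_le (hAr h hh)))
  rw [integral_add hkint hknint, hneg, integral_const_mul] at hsum
  linarith

theorem setIntegral_annulus_scale {d : ℕ} {ρ : ℝ} (hρ : 0 < ρ) (x : EuclideanSpace ℝ (Fin d))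
    (R r : ℝ) :
    ∫ y in ball (ρ • x) R \ ball (ρ • x) r,
        chiDiff (closedBall 0 ρ) y / ‖y - ρ • x‖ ^ (d : ℝ) =
      ∫ h in ball (0 : EuclideanSpace ℝ (Fin d)) (R / ρ) \ ball 0 (r / ρ),
        chiDiff (closedBall 0 1) (x + h) / ‖h‖ ^ (d : ℝ) := by
  have hchi : ∀ z : EuclideanSpace ℝ (Fin d),
      chiDiff (closedBall 0 ρ) (ρ • z) = chiDiff (closedBall 0 1) z := fun z => by
    have : ρ • z ∈ closedBall (0 : EuclideanSpace ℝ (Fin d)) ρ ↔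
        z ∈ closedBall (0 : EuclideanSpace ℝ (Fin d)) 1 := by
      rw [mem_closedBall_zero_iff, mem_closedBall_zero_iff, norm_smul, Real.norm_of_nonneg hρ.le,
        mul_le_iff_le_one_right hρ]
    by_cases hz : z ∈ closedBall (0 : EuclideanSpace ℝ (Fin d)) 1
    · rw [chiDiff, chiDiff, Set.indicator_of_mem hz, Set.indicator_of_mem (this.2 hz),
        Set.indicator_of_notMem (not_not.2 (this.2 hz)), Set.indicator_of_notMem (not_not.2 hz)]
    · have hz' := mt this.1 hz
      rw [chiDiff, chiDiff, Set.indicator_of_notMem hz, Set.indicator_of_notMem hz',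
        Set.indicator_of_mem (mem_compl hz), Set.indicator_of_mem (mem_compl hz')]
  rw [← integral_indicator (measurableSet_ball.diff measurableSet_ball),
    ← integral_indicator (measurableSet_ball.diff measurableSet_ball)]
  set f : EuclideanSpace ℝ (Fin d) → ℝ := (ball (ρ • x) R \ ball (ρ • x) r).indicator
    fun y => chiDiff (closedBall 0 ρ) y / ‖y - ρ • x‖ ^ (d : ℝ) with hf
  have h1 := Measure.integral_comp_smul (volume : Measure (EuclideanSpace ℝ (Fin d)))
    f ρ
  have h2 : ∫ h, f (ρ • (x + h)) = ∫ z, f (ρ • z) :=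
    integral_add_left_eq_self (fun z => f (ρ • z)) x
  have hρd : 0 < ρ ^ d := by positivity
  rw [finrank_euclideanSpace_fin, abs_of_pos (inv_pos.2 hρd), smul_eq_mul] at h1
  have h3 : ∫ y, f y = ∫ h, ρ ^ d * f (ρ • (x + h)) := by
    rw [integral_const_mul, h2, h1, mul_inv_cancel_left₀ hρd.ne']
  rw [h3]
  congr 1
  ext h
  have hsub : ρ • (x + h) - ρ • x = ρ • h := by rw [smul_add, add_sub_cancel_left]
  have hmem : ∀ T : ℝ, ρ • (x + h) ∈ ball (ρ • x) T ↔
      h ∈ ball (0 : EuclideanSpace ℝ (Fin d)) (T / ρ) := fun T => by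
    rw [mem_ball_iff_norm, hsub, norm_smul, Real.norm_of_nonneg hρ.le, mem_ball_zero_iff,
      lt_div_iff₀' hρ]
  have hiff : ρ • (x + h) ∈ ball (ρ • x) R \ ball (ρ • x) r ↔
      h ∈ ball (0 : EuclideanSpace ℝ (Fin d)) (R / ρ) \ ball 0 (r / ρ) :=
    and_congr (hmem R) (not_congr (hmem r))
  by_cases hh : h ∈ ball (0 : EuclideanSpace ℝ (Fin d)) (R / ρ) \ ball 0 (r / ρ)
  · rw [hf, Set.indicator_of_mem hh, Set.indicator_of_mem (hiff.2 hh), hsub, hchi, norm_smul,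
      Real.norm_of_nonneg hρ.le, Real.mul_rpow hρ.le (norm_nonneg _), Real.rpow_natCast ρ]
    field_simp
  · rw [hf, Set.indicator_of_notMem hh, Set.indicator_of_notMem (mt hiff.1 hh), mul_zero]

theorem setIntegral_gapKernel_annulus {d : ℕ} (hd : 0 < d) {x : EuclideanSpace ℝ (Fin d)}
    (hx : ‖x‖ = 1) {a b : ℝ} (ha : 2 < a) (hab : a ≤ b) :
    ∫ h in ball 0 b, gapKernel x h =
      (∫ h in ball 0 a, gapKernel x h) + d * unitBallVol d * Real.log (b / a) := by
  have hsub : ball (0 : EuclideanSpace ℝ (Fin d)) a ⊆ ball 0 b := ball_subset_ball hab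
  have hint := integrableOn_gapKernel hd hx b
  rw [← sub_eq_iff_eq_add', ← setIntegral_sdiff measurableSet_ball hint hsub]
  have : Nonempty (Fin d) := ⟨⟨0, hd⟩⟩
  rw [← integral_indicator (measurableSet_ball.diff measurableSet_ball)]
  set f : ℝ → ℝ := (Ico a b).indicator fun t => 1 / t ^ (d : ℝ) with hf
  have h1 : ∀ h, (ball (0 : EuclideanSpace ℝ (Fin d)) b \ ball 0 a).indicator (gapKernel x) h =
      f ‖h‖ := fun h => by
    have hiff : h ∈ ball (0 : EuclideanSpace ℝ (Fin d)) b \ ball 0 a ↔ ‖h‖ ∈ Ico a b := by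
      simp [and_comm]
    by_cases hh : ‖h‖ ∈ Ico a b
    · rw [hf, Set.indicator_of_mem hh, Set.indicator_of_mem (hiff.2 hh)]
      refine Set.indicator_of_mem ?_ _
      have h2 := abs_real_inner_le_norm x h
      rw [hx, one_mul] at h2
      have h3 : 2 < ‖h‖ := ha.trans_le hh.1
      rw [mem_ofPred_eq]
      nlinarith
    · rw [hf, Set.indicator_of_notMem hh, Set.indicator_of_notMem (fun h' => hh (hiff.1 h'))]
  simp only [h1]
  rw [integral_fun_norm_addHaar, finrank_euclideanSpace_fin]
  have h2 : ∫ y in Ioi (0 : ℝ), y ^ (d - 1) • f y = Real.log (b / a) := by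
    rw [← integral_inv_of_pos (by linarith) (by linarith), intervalIntegral.integral_of_le hab,
      ← integral_Ico_eq_integral_Ioc, ← integral_indicator measurableSet_Ico,
      ← integral_indicator measurableSet_Ioi]
    congr 1
    ext y
    by_cases hy : y ∈ Ico a b
    · have hy0 : 0 < y := by linarith [hy.1]
      rw [Set.indicator_of_mem hy, Set.indicator_of_mem (mem_Ioi.2 hy0), hf,
        Set.indicator_of_mem hy, Real.rpow_natCast, smul_eq_mul]
      obtain ⟨n, rfl⟩ := Nat.exists_eq_succ_of_ne_zero hd.ne'
      simp only [Nat.succ_eq_add_one, Nat.add_sub_cancel, pow_succ]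
      field_simp
    · rw [Set.indicator_of_notMem hy]
      simp [hf, Set.indicator_of_notMem hy, Set.indicator]
  rw [h2, nsmul_eq_mul, smul_eq_mul, unitBallVol, Measure.real]
  ring

theorem tendsto_setIntegral_gapKernel {d : ℕ} (hd : 0 < d) {x : EuclideanSpace ℝ (Fin d)}
    (hx : ‖x‖ = 1) (S : ℝ) {ρ : ℝ} (hρ : 0 < ρ) :
    Tendsto (fun r : ℝ => ∫ h in ball 0 S \ ball 0 (r / ρ), gapKernel x h)
      (nhdsWithin 0 (Ioi 0)) (nhds (∫ h in ball 0 S, gapKernel x h)) := by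
  have hint := integrableOn_gapKernel hd hx S
  have heq : ∀ r : ℝ, ∫ h in ball 0 S \ ball 0 (r / ρ), gapKernel x h =
      ∫ h in ball 0 S, (ball 0 (r / ρ))ᶜ.indicator (gapKernel x) h := fun r => by
    rw [setIntegral_indicator measurableSet_ball.compl, sdiff_eq]
  simp only [heq]
  refine tendsto_integral_filter_of_dominated_convergence (gapKernel x)
    (Eventually.of_forall fun r =>
      ((measurable_gapKernel x).indicator measurableSet_ball.compl).aestronglyMeasurable)
    (Eventually.of_forall fun r => ae_of_all _ fun h => ?_) hint (ae_of_all _ fun h => ?_)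
  · rw [Real.norm_of_nonneg (Set.indicator_nonneg (fun h _ => gapKernel_nonneg x h) _)]
    exact Set.indicator_le_self' (fun h _ => gapKernel_nonneg x h) _
  · by_cases hh : h = 0
    · have h0 : gapKernel x h = 0 := by simp [gapKernel, hh]
      simp [Set.indicator, h0]
    · refine tendsto_const_nhds.congr' ?_
      have hpos : 0 < ‖h‖ * ρ := by positivity
      filter_upwards [nhdsWithin_le_nhds (Iio_mem_nhds hpos)] with r hr
      rw [Set.indicator_of_mem]
      rw [mem_compl_iff, mem_ball_zero_iff, not_lt]
      exact ((div_lt_iff₀ hρ).2 hr).le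

theorem H0_closedBall_eq {d : ℕ} (hd : 0 < d) {x : EuclideanSpace ℝ (Fin d)} (hx : ‖x‖ = 1)
    {ρ : ℝ} (hρ : 0 < ρ) :
    H0 (closedBall (0 : EuclideanSpace ℝ (Fin d)) ρ) (ρ • x) =
      (∫ h in ball 0 3, gapKernel x h) - d * unitBallVol d * Real.log 3
        - d * unitBallVol d * Real.log ρ := by
  have : Nonempty (Fin d) := ⟨⟨0, hd⟩⟩
  have hlim : Tendsto (fun r : ℝ => ∫ y in ball (ρ • x) (2 * ρ + 1) \ ball (ρ • x) r,
      chiDiff (closedBall 0 ρ) y / ‖y - ρ • x‖ ^ (d : ℝ)) (nhdsWithin 0 (Ioi 0))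
      (nhds (∫ h in ball 0 ((2 * ρ + 1) / ρ), gapKernel x h)) := by
    refine (tendsto_setIntegral_gapKernel hd hx ((2 * ρ + 1) / ρ) hρ).congr' ?_
    filter_upwards [self_mem_nhdsWithin] with r hr
    rw [setIntegral_annulus_scale hρ, setIntegral_chiDiff_eq_gapKernel hx _ (div_pos hr hρ)]
  unfold H0
  rw [Metric.diam_closedBall_eq _ hρ.le, hlim.limUnder_eq]
  have hS : 2 < (2 * ρ + 1) / ρ := by
    rw [lt_div_iff₀ hρ]
    linarith
  have hlog : Real.log (2 * ρ + 1) = Real.log ((2 * ρ + 1) / ρ) + Real.log ρ := by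
    rw [Real.log_div (by positivity) hρ.ne']
    ring
  rw [hlog]
  rcases le_total 3 ((2 * ρ + 1) / ρ) with h3 | h3
  · rw [setIntegral_gapKernel_annulus hd hx (by norm_num) h3,
      Real.log_div (x := (2 * ρ + 1) / ρ) (by positivity) (by norm_num)]
    ring
  · rw [setIntegral_gapKernel_annulus hd hx hS h3,
      Real.log_div (x := 3) (by norm_num) (by positivity)]
    ring

end FractionalCurvatureOfBalls

/-- `H^0(ρx, B̄_ρ) = H^0(x, B̄_1) - d ω_d log ρ` for unit vectors `x`,
and in particular `H^0(ρx, B̄_ρ) ≥ -Kρ` for all `ρ ≥ 1` for some `K > 0`. -/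
theorem stmt_6 (d : ℕ) (hd : 0 < d) :
    (∀ ρ : ℝ, 0 < ρ → ∀ x : EuclideanSpace ℝ (Fin d), ‖x‖ = 1 →
      H0 (Metric.closedBall (0 : EuclideanSpace ℝ (Fin d)) ρ) (ρ • x)
        = H0 (Metric.closedBall (0 : EuclideanSpace ℝ (Fin d)) 1) x
          - d * unitBallVol d * Real.log ρ) ∧
    ∃ K : ℝ, 0 < K ∧ ∀ ρ : ℝ, 1 ≤ ρ → ∀ x : EuclideanSpace ℝ (Fin d), ‖x‖ = 1 →
      -K * ρ ≤ H0 (Metric.closedBall (0 : EuclideanSpace ℝ (Fin d)) ρ) (ρ • x) := by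
  have hω : 0 ≤ unitBallVol d := ENNReal.toReal_nonneg
  refine ⟨fun ρ hρ x hx => ?_, d * unitBallVol d * (Real.log 3 + 1) + 1, ?_, fun ρ hρ x hx => ?_⟩
  · have h1 := H0_closedBall_eq hd hx one_pos
    rw [one_smul, Real.log_one, mul_zero, sub_zero] at h1
    rw [H0_closedBall_eq hd hx hρ, h1]
  · have := Real.log_pos (show (1 : ℝ) < 3 by norm_num)
    positivity
  · rw [H0_closedBall_eq hd hx (by linarith)]
    have hI : 0 ≤ ∫ h in ball 0 3, gapKernel x h :=
      integral_nonneg fun h => gapKernel_nonneg x h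
    have hlog3 := Real.log_pos (show (1 : ℝ) < 3 by norm_num)
    have hlog : Real.log ρ ≤ ρ := Real.log_le_self (by linarith)
    have hc : 0 ≤ d * unitBallVol d := by positivity
    have h1 : d * unitBallVol d * Real.log ρ ≤ d * unitBallVol d * ρ := by gcongr
    have h2 : d * unitBallVol d * Real.log 3 ≤ d * unitBallVol d * Real.log 3 * ρ :=
      le_mul_of_one_le_right (by positivity) hρ
    linarith
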